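/- arXiv:2604.12853 — 3 statements merged into one kernel-verified Lean document; each statement's English description precedes it below -/
import Mathlib

section
/- In the standing setup, let k ≥ 0, let (a_0,b_0), …, (a_k,b_k) ∈ Δ with c_i = f(a_i) = g(b_i), and suppose α_Z(c_0) > 0. Then for every m ≥ k, P(W^m_0 = (a_0,b_0), …, W^m_k = (a_k,b_k)) = E[ P(X^m_0=a_0,…,X^m_k=a_k | Z)·P(Y^m_0=b_0,…,Y^m_k=b_k | Z) ] = (α_X(a_0)·α_Y(b_0)/α_Z(c_0)) · (Π_{i=1}^{k} R((a_{i−1},b_{i−1}),(a_i,b_i))) · φ_{m−k}(a_k,b_k). -/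
open MeasureTheory Filter Topology
open scoped ENNReal Classical

/-- A probability vector on a countable state space. -/
def IsProbVec {U : Type*} (v : U → ℝ≥0∞) : Prop := ∑' u, v u = 1

/-- A row-stochastic matrix on a countable state space. -/
def IsStochastic {U : Type*} (P : U → U → ℝ≥0∞) : Prop := ∀ u, ∑' w, P u w = 1

/-- `μ` is the law of the time-homogeneous Markov chain `MC(v,P)`. -/
def IsMarkovChain {U : Type*} [MeasurableSpace U]
    (v : U → ℝ≥0∞) (P : U → U → ℝ≥0∞) (μ : Measure (ℕ → U)) : Prop :=
  IsProbabilityMeasure μ ∧ IsProbVec v ∧ IsStochastic P ∧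
    ∀ (k : ℕ) (a : ℕ → U),
      μ {ω | ∀ i ≤ k, ω i = a i} = v (a 0) * ∏ i ∈ Finset.range k, P (a i) (a (i + 1))

/-- `Δ(f,g) = {(a,b) : f a = g b}`. -/
abbrev Delta {A B C : Type*} (f : A → C) (g : B → C) :=
  {p : A × B // f p.1 = g p.2}

/-- The matrix `R` on `Δ(f,g)`:
`R((a,b),(a',b')) = P_X(a,a') * P_Y(b,b') / P_Z(f a, f a')` when `P_Z(f a, f a') > 0`,
else `0`. -/
noncomputable def Rmat {A B C : Type*} (PX : A → A → ℝ≥0∞) (PY : B → B → ℝ≥0∞)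
    (PZ : C → C → ℝ≥0∞) (f : A → C) (g : B → C) (d e : Delta f g) : ℝ≥0∞ :=
  if PZ (f d.1.1) (f e.1.1) ≠ 0 then
    PX d.1.1 e.1.1 * PY d.1.2 e.1.2 / PZ (f d.1.1) (f e.1.1)
  else 0

/-- `phim R m = R^m 1`, computed coordinatewise in `[0,∞]`. -/
noncomputable def phim {D : Type*} (R : D → D → ℝ≥0∞) : ℕ → D → ℝ≥0∞
  | 0 => fun _ => 1
  | m + 1 => fun d => ∑' e, R d e * phim R m e

/-- The conditional probability of the cylinder event `{X_0 = a_0, …, X_k = a_k}` given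
`f(X_0) = z_0, …, f(X_m) = z_m`, as a function of the image trajectory `z`. -/
noncomputable def condCyl {A C : Type*} [MeasurableSpace A]
    (μ : Measure (ℕ → A)) (f : A → C) (z : ℕ → C) (m k : ℕ) (a : Fin (k + 1) → A) : ℝ≥0∞ :=
  μ {ω | (∀ i : Fin (k + 1), ω i.1 = a i) ∧ ∀ j ≤ m, f (ω j) = z j}
    / μ {ω | ∀ j ≤ m, f (ω j) = z j}

/-- Cylinder probabilities of a Markov chain, indexed by `Fin`. -/
theorem IsMarkovChain.measure_cylinder {U : Type*} [MeasurableSpace U]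
    {v : U → ℝ≥0∞} {P : U → U → ℝ≥0∞} {μ : Measure (ℕ → U)} (h : IsMarkovChain v P μ)
    {k : ℕ} (a : Fin (k + 1) → U) :
    μ {ω | ∀ i : Fin (k + 1), ω i.1 = a i}
      = v (a 0) * ∏ i : Fin k, P (a i.castSucc) (a i.succ) := by
  have key := h.2.2.2 k (fun n => if hn : n < k + 1 then a ⟨n, hn⟩ else a 0)
  have hset : {ω : ℕ → U | ∀ i : Fin (k + 1), ω i.1 = a i}
      = {ω | ∀ i ≤ k, ω i = if hn : i < k + 1 then a ⟨i, hn⟩ else a 0} := by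
    ext ω
    simp only [Set.mem_ofPred_eq]
    constructor
    · intro hω i hi
      rw [dif_pos (Nat.lt_succ_of_le hi)]
      exact hω ⟨i, Nat.lt_succ_of_le hi⟩
    · intro hω i
      have := hω i.1 (Nat.le_of_lt_succ i.2)
      rwa [dif_pos i.2] at this
  rw [hset, key, Finset.prod_range]
  congr 1
  refine Finset.prod_congr rfl fun i _ => ?_
  rw [dif_pos (by omega), dif_pos (by omega)]
  rfl

theorem IsMarkovChain.init_ne_top {U : Type*} [MeasurableSpace U]
    {v : U → ℝ≥0∞} {P : U → U → ℝ≥0∞} {μ : Measure (ℕ → U)} (h : IsMarkovChain v P μ) (u : U) :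
    v u ≠ ⊤ :=
  ne_top_of_le_ne_top ENNReal.one_ne_top ((ENNReal.le_tsum u).trans_eq h.2.1)

theorem IsMarkovChain.trans_ne_top {U : Type*} [MeasurableSpace U]
    {v : U → ℝ≥0∞} {P : U → U → ℝ≥0∞} {μ : Measure (ℕ → U)} (h : IsMarkovChain v P μ)
    (u w : U) : P u w ≠ ⊤ :=
  ne_top_of_le_ne_top ENNReal.one_ne_top ((ENNReal.le_tsum w).trans_eq (h.2.2.1 u))

/-- A path in the image chain has the same probability under the lifted law. -/
theorem measure_image_path {A C : Type*} [Countable A] [Countable C]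
    [MeasurableSpace A] [MeasurableSingletonClass A]
    [MeasurableSpace C] [MeasurableSingletonClass C]
    {μ : Measure (ℕ → A)} {ν : Measure (ℕ → C)} {f : A → C}
    (h : μ.map (fun ω n => f (ω n)) = ν) (m : ℕ) (z : ℕ → C) :
    μ {ω | ∀ j ≤ m, f (ω j) = z j} = ν {ω | ∀ j ≤ m, ω j = z j} := by
  have hm : Measurable (fun (ω : ℕ → A) n => f (ω n)) :=
    measurable_pi_lambda _ fun n => (measurable_of_countable f).comp (measurable_pi_apply n)
  rw [← h, Measure.map_apply hm]
  · rfl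
  · have : {ω : ℕ → C | ∀ j ≤ m, ω j = z j} = ⋂ j, ⋂ (_ : j ≤ m), (fun ω => ω j) ⁻¹' {z j} := by
      ext; simp
    rw [this]
    exact MeasurableSet.iInter fun j => MeasurableSet.iInter fun _ =>
      measurable_pi_apply j (measurableSet_singleton _)

theorem measurable_condCyl {A C : Type*} [Countable C] [MeasurableSpace A]
    [MeasurableSpace C] [MeasurableSingletonClass C]
    (μ : Measure (ℕ → A)) (f : A → C) (m k : ℕ) (a : Fin (k + 1) → A) :
    Measurable fun z : ℕ → C => condCyl μ f z m k a := by
  let F : (Fin (m + 1) → C) → ℝ≥0∞ := fun y =>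
    μ {ω | (∀ i : Fin (k + 1), ω i.1 = a i) ∧ ∀ j : Fin (m + 1), f (ω j) = y j}
      / μ {ω | ∀ j : Fin (m + 1), f (ω j) = y j}
  have hF : (fun z : ℕ → C => condCyl μ f z m k a) = F ∘ fun z j => z j.1 := by
    funext z
    simp only [condCyl, F, Function.comp, Fin.forall_iff, Nat.lt_succ_iff]
  rw [hF]
  exact (measurable_of_countable F).comp
    (measurable_pi_lambda _ fun j => measurable_pi_apply j.1)

theorem condCyl_eq_zero {A C : Type*} [MeasurableSpace A]
    (μ : Measure (ℕ → A)) (f : A → C) (z : ℕ → C) {m k : ℕ} (hkm : k ≤ m)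
    (a : Fin (k + 1) → A) (i : Fin (k + 1)) (hi : f (a i) ≠ z i) :
    condCyl μ f z m k a = 0 := by
  have : {ω : ℕ → A | (∀ i : Fin (k + 1), ω i.1 = a i) ∧ ∀ j ≤ m, f (ω j) = z j} = ∅ := by
    ext ω
    simp only [Set.mem_ofPred_eq, Set.mem_empty_iff_false, iff_false]
    rintro ⟨h1, h2⟩
    exact hi (by rw [← h1 i]; exact h2 i (by omega))
  rw [condCyl, this, measure_empty, ENNReal.zero_div]

/-- Total probability over the next state. -/
theorem condCyl_eq_tsum_snoc {A C : Type*} [Countable A] [Countable C]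
    [MeasurableSpace A] [MeasurableSingletonClass A]
    (μ : Measure (ℕ → A)) (f : A → C) (z : ℕ → C) (m k : ℕ) (a : Fin (k + 1) → A) :
    condCyl μ f z m k a
      = ∑' x : A, condCyl μ f z m (k + 1) (Fin.snoc (α := fun _ => A) a x) := by
  simp only [condCyl, div_eq_mul_inv]
  rw [ENNReal.tsum_mul_right]
  congr 1
  rw [← measure_iUnion]
  · congr 1
    ext ω
    simp only [Set.mem_ofPred_eq, Set.mem_iUnion, Fin.forall_fin_succ' (n := k + 1),
      Fin.snoc_castSucc, Fin.snoc_last, Fin.val_castSucc, Fin.val_last]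
    constructor
    · rintro ⟨h1, h2⟩
      exact ⟨_, ⟨h1, rfl⟩, h2⟩
    · rintro ⟨x, ⟨h1, _⟩, h2⟩
      exact ⟨h1, h2⟩
  · intro x y hxy
    refine Set.disjoint_left.2 fun ω hx hy => hxy ?_
    have h1 := hx.1 (Fin.last _)
    have h2 := hy.1 (Fin.last _)
    rw [Fin.snoc_last] at h1 h2
    exact h1.symm.trans h2
  · intro x
    have : {ω : ℕ → A | (∀ i : Fin (k + 1 + 1), ω i.1 = Fin.snoc (α := fun _ => A) a x i)
          ∧ ∀ j ≤ m, f (ω j) = z j}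
        = (⋂ i : Fin (k + 1 + 1), (fun ω => ω i.1) ⁻¹' {Fin.snoc (α := fun _ => A) a x i})
          ∩ ⋂ j, ⋂ (_ : j ≤ m), (fun ω => ω j) ⁻¹' (f ⁻¹' {z j}) := by
      ext; simp
    rw [this]
    refine (MeasurableSet.iInter fun i : Fin (k + 1 + 1) =>
        measurable_pi_apply i.1 (measurableSet_singleton _)).inter
      (MeasurableSet.iInter fun j => MeasurableSet.iInter fun _ =>
        measurable_pi_apply j (Set.to_countable _).measurableSet)

/-- Cylinder probability of the coupling that conditions on the image path up to time `m`. -/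
noncomputable def couplingCyl {A B C : Type*} [MeasurableSpace A] [MeasurableSpace B]
    [MeasurableSpace C] (μX : Measure (ℕ → A)) (μY : Measure (ℕ → B)) (μZ : Measure (ℕ → C))
    (f : A → C) (g : B → C) (m k : ℕ) (d : Fin (k + 1) → Delta f g) : ℝ≥0∞ :=
  ∫⁻ z, condCyl μX f z m k (fun i => (d i).1.1) * condCyl μY g z m k (fun i => (d i).1.2) ∂μZ

section

variable {A B C : Type*} [Countable A] [Countable B] [Countable C]
  [MeasurableSpace A] [MeasurableSingletonClass A]
  [MeasurableSpace B] [MeasurableSingletonClass B]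
  [MeasurableSpace C] [MeasurableSingletonClass C]

theorem couplingCyl_eq_tsum_snoc (μX : Measure (ℕ → A)) (μY : Measure (ℕ → B))
    (μZ : Measure (ℕ → C)) (f : A → C) (g : B → C) {m k : ℕ} (hkm : k + 1 ≤ m)
    (d : Fin (k + 1) → Delta f g) :
    couplingCyl μX μY μZ f g m k d
      = ∑' e : Delta f g,
        couplingCyl μX μY μZ f g m (k + 1) (Fin.snoc (α := fun _ => Delta f g) d e) := by
  unfold couplingCyl
  have hmeas (e : Delta f g) : AEMeasurable (fun z =>
      condCyl μX f z m (k + 1) (fun i => (Fin.snoc (α := fun _ => Delta f g) d e i).1.1)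
        * condCyl μY g z m (k + 1) (fun i => (Fin.snoc (α := fun _ => Delta f g) d e i).1.2)) μZ :=
    ((measurable_condCyl _ _ _ _ _).mul (measurable_condCyl _ _ _ _ _)).aemeasurable
  rw [← lintegral_tsum hmeas]
  refine lintegral_congr fun z => ?_
  rw [condCyl_eq_tsum_snoc μX, condCyl_eq_tsum_snoc μY, ← ENNReal.tsum_mul_right]
  simp_rw [← ENNReal.tsum_mul_left]
  rw [← ENNReal.tsum_prod (f := fun x y =>
    condCyl μX f z m (k + 1) (Fin.snoc (α := fun _ => A) (fun i => (d i).1.1) x)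
      * condCyl μY g z m (k + 1) (Fin.snoc (α := fun _ => B) (fun i => (d i).1.2) y))]
  symm
  have hsub := tsum_subtype_eq_of_support_subset (s := {p : A × B | f p.1 = g p.2})
    (f := fun p : A × B =>
      condCyl μX f z m (k + 1) (Fin.snoc (α := fun _ => A) (fun i => (d i).1.1) p.1)
      * condCyl μY g z m (k + 1) (Fin.snoc (α := fun _ => B) (fun i => (d i).1.2) p.2)) (by
    intro p hp
    by_contra hne
    apply hp
    by_cases hx : f p.1 = z (k + 1)
    · have hy : g p.2 ≠ z (k + 1) := fun h => hne (hx.trans h.symm)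
      simp only
      rw [condCyl_eq_zero μY g z hkm _ (Fin.last _) (by rw [Fin.snoc_last]; exact hy), mul_zero]
    · simp only
      rw [condCyl_eq_zero μX f z hkm _ (Fin.last _) (by rw [Fin.snoc_last]; exact hx), zero_mul])
  rw [← hsub]
  refine tsum_congr fun e => ?_
  congr 2
  · funext i
    refine Fin.lastCases ?_ (fun j => ?_) i
    · simp only [Fin.snoc_last]
    · simp only [Fin.snoc_castSucc]
  · funext i
    refine Fin.lastCases ?_ (fun j => ?_) i
    · simp only [Fin.snoc_last]
    · simp only [Fin.snoc_castSucc]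

variable {αX : A → ℝ≥0∞} {PX : A → A → ℝ≥0∞} {μX : Measure (ℕ → A)}
  {αY : B → ℝ≥0∞} {PY : B → B → ℝ≥0∞} {μY : Measure (ℕ → B)}
  {αZ : C → ℝ≥0∞} {PZ : C → C → ℝ≥0∞} {μZ : Measure (ℕ → C)}
  {f : A → C} {g : B → C}

theorem couplingCyl_self
    (hX : IsMarkovChain αX PX μX) (hY : IsMarkovChain αY PY μY) (hZ : IsMarkovChain αZ PZ μZ)
    (hfX : μX.map (fun ω n => f (ω n)) = μZ) (hgY : μY.map (fun ω n => g (ω n)) = μZ)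
    {k : ℕ} (d : Fin (k + 1) → Delta f g) (hc0 : αZ (f (d 0).1.1) ≠ 0) :
    couplingCyl μX μY μZ f g k k d
      = αX (d 0).1.1 * αY (d 0).1.2 / αZ (f (d 0).1.1)
        * ∏ i : Fin k, Rmat PX PY PZ f g (d i.castSucc) (d i.succ) := by
  set E : Set (ℕ → C) := {z | ∀ i : Fin (k + 1), z i.1 = f (d i).1.1} with hE
  have hEm : MeasurableSet E := by
    have : E = ⋂ i : Fin (k + 1), (fun ω => ω i.1) ⁻¹' {f (d i).1.1} := by
      ext; simp [hE]
    rw [this]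
    exact MeasurableSet.iInter fun i => measurable_pi_apply i.1 (measurableSet_singleton _)
  have hME := hZ.measure_cylinder fun i => f (d i).1.1
  rw [← hE] at hME
  have hMX := hX.measure_cylinder fun i => (d i).1.1
  have hMY := hY.measure_cylinder fun i => (d i).1.2
  have hpath : ∀ z ∈ E, {ω : ℕ → C | ∀ j ≤ k, ω j = z j} = E := by
    intro z hz
    ext ω
    constructor
    · intro h i
      exact (h i (by omega)).trans (hz i)
    · intro h j hj
      exact (h ⟨j, by omega⟩).trans (hz ⟨j, by omega⟩).symm
  have hint : ∀ z, condCyl μX f z k k (fun i => (d i).1.1)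
        * condCyl μY g z k k (fun i => (d i).1.2)
      = E.indicator (fun _ => μX {ω | ∀ i : Fin (k + 1), ω i.1 = (d i).1.1} / μZ E
        * (μY {ω | ∀ i : Fin (k + 1), ω i.1 = (d i).1.2} / μZ E)) z := by
    intro z
    by_cases hz : z ∈ E
    · rw [Set.indicator_of_mem hz, condCyl, condCyl, measure_image_path hfX,
        measure_image_path hgY, hpath z hz]
      congr 4
      · ext ω
        simp only [and_iff_left_iff_imp]
        intro h j hj
        have := h ⟨j, by omega⟩
        simp only at this
        rw [this]
        exact (hz ⟨j, by omega⟩).symm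
      · ext ω
        simp only [and_iff_left_iff_imp]
        intro h j hj
        have := h ⟨j, by omega⟩
        simp only at this
        rw [this, ← (d ⟨j, by omega⟩).2]
        exact (hz ⟨j, by omega⟩).symm
    · rw [Set.indicator_of_notMem hz]
      simp only [hE, Set.mem_ofPred_eq, not_forall] at hz
      obtain ⟨i, hi⟩ := hz
      rw [condCyl_eq_zero μX f z le_rfl _ i (fun h => hi h.symm), zero_mul]
  unfold couplingCyl
  rw [lintegral_congr hint, lintegral_indicator_const hEm]
  by_cases h0 : ∃ i : Fin k, PZ (f (d i.castSucc).1.1) (f (d i.succ).1.1) = 0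
  · obtain ⟨i, hi⟩ := h0
    have hR : Rmat PX PY PZ f g (d i.castSucc) (d i.succ) = 0 := by
      simp [Rmat, hi]
    rw [Finset.prod_eq_zero (Finset.mem_univ i) hR, hME,
      Finset.prod_eq_zero (Finset.mem_univ i) hi]
    simp
  · push Not at h0
    have hR : ∀ i : Fin k, Rmat PX PY PZ f g (d i.castSucc) (d i.succ)
        = PX (d i.castSucc).1.1 (d i.succ).1.1 * PY (d i.castSucc).1.2 (d i.succ).1.2
          * (PZ (f (d i.castSucc).1.1) (f (d i.succ).1.1))⁻¹ := by
      intro i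
      rw [Rmat, if_pos (h0 i), div_eq_mul_inv]
    have hP0 : ∏ i : Fin k, PZ (f (d i.castSucc).1.1) (f (d i.succ).1.1) ≠ 0 :=
      Finset.prod_ne_zero_iff.2 fun i _ => h0 i
    have hPt : ∏ i : Fin k, PZ (f (d i.castSucc).1.1) (f (d i.succ).1.1) ≠ ⊤ :=
      ENNReal.prod_ne_top fun i _ => hZ.trans_ne_top _ _
    have hE0 : μZ E ≠ 0 := by rw [hME]; exact mul_ne_zero hc0 hP0
    have hEt : μZ E ≠ ⊤ := by rw [hME]; exact ENNReal.mul_ne_top (hZ.init_ne_top _) hPt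
    have hinv : ∏ i : Fin k, (PZ (f (d i.castSucc).1.1) (f (d i.succ).1.1))⁻¹
        = (∏ i : Fin k, PZ (f (d i.castSucc).1.1) (f (d i.succ).1.1))⁻¹ :=
      (ENNReal.prod_inv_distrib fun i _ j _ _ => Or.inl (h0 i)).symm
    rw [mul_assoc, ENNReal.div_mul_cancel hE0 hEt, Finset.prod_congr rfl fun i _ => hR i,
      Finset.prod_mul_distrib, Finset.prod_mul_distrib, hinv, hMX, hMY, hME, div_eq_mul_inv,
      div_eq_mul_inv, ENNReal.mul_inv (Or.inl hc0) (Or.inr hP0)]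
    ring

theorem couplingCyl_eq
    (hX : IsMarkovChain αX PX μX) (hY : IsMarkovChain αY PY μY) (hZ : IsMarkovChain αZ PZ μZ)
    (hfX : μX.map (fun ω n => f (ω n)) = μZ) (hgY : μY.map (fun ω n => g (ω n)) = μZ)
    (n : ℕ) {k : ℕ} (d : Fin (k + 1) → Delta f g) (hc0 : αZ (f (d 0).1.1) ≠ 0) :
    couplingCyl μX μY μZ f g (k + n) k d
      = αX (d 0).1.1 * αY (d 0).1.2 / αZ (f (d 0).1.1)
        * (∏ i : Fin k, Rmat PX PY PZ f g (d i.castSucc) (d i.succ))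
        * phim (Rmat PX PY PZ f g) n (d (Fin.last k)) := by
  induction n generalizing k with
  | zero => rw [add_zero, couplingCyl_self hX hY hZ hfX hgY d hc0, phim, mul_one]
  | succ n ih =>
    rw [couplingCyl_eq_tsum_snoc μX μY μZ f g (by omega) d, phim, ← ENNReal.tsum_mul_left]
    refine tsum_congr fun e => ?_
    have hzero : Fin.snoc (α := fun _ => Delta f g) d e 0 = d 0 :=
      Fin.snoc_castSucc (α := fun _ => Delta f g) e d 0
    have hstep := ih (Fin.snoc (α := fun _ => Delta f g) d e) (by rw [hzero]; exact hc0)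
    rw [show k + (n + 1) = k + 1 + n by omega, hstep, hzero, Fin.prod_univ_castSucc]
    simp only [Fin.snoc_castSucc, Fin.snoc_last, Fin.succ_castSucc, Fin.succ_last]
    ring

end

/-- **Joint distribution of `W^m_0, …, W^m_k` when `m ≥ k`.** The coupling `W^m` is obtained by
conditioning `X̄` and `Ȳ`, conditionally independently given `Z`, on agreeing with `Z` under
`f`, `g` up to time `m`.  Its cylinder probability
`P(W^m_0 = (a_0,b_0), …, W^m_k = (a_k,b_k))`, which by construction equals
`E[P(X^m_0 = a_0, …, X^m_k = a_k ∣ Z) * P(Y^m_0 = b_0, …, Y^m_k = b_k ∣ Z)]`, equals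
`(α_X(a_0) α_Y(b_0) / α_Z(c_0)) * Π_{i=1}^k R((a_{i-1},b_{i-1}),(a_i,b_i)) * φ_{m-k}(a_k,b_k)`.
-/
theorem statement_9
    {A B C : Type*} [Countable A] [Countable B] [Countable C]
    [MeasurableSpace A] [MeasurableSingletonClass A]
    [MeasurableSpace B] [MeasurableSingletonClass B]
    [MeasurableSpace C] [MeasurableSingletonClass C]
    (αX : A → ℝ≥0∞) (PX : A → A → ℝ≥0∞) (μX : Measure (ℕ → A))
    (αY : B → ℝ≥0∞) (PY : B → B → ℝ≥0∞) (μY : Measure (ℕ → B))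
    (αZ : C → ℝ≥0∞) (PZ : C → C → ℝ≥0∞) (μZ : Measure (ℕ → C))
    (f : A → C) (g : B → C)
    (hX : IsMarkovChain αX PX μX) (hY : IsMarkovChain αY PY μY)
    (hZ : IsMarkovChain αZ PZ μZ)
    (hfX : μX.map (fun ω n => f (ω n)) = μZ)
    (hgY : μY.map (fun ω n => g (ω n)) = μZ)
    (k m : ℕ) (hmk : k ≤ m)
    (a : Fin (k + 1) → A) (b : Fin (k + 1) → B)
    (hΔ : ∀ i, f (a i) = g (b i))
    (hc0 : αZ (f (a 0)) ≠ 0) :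
    ∫⁻ z, condCyl μX f z m k a * condCyl μY g z m k b ∂μZ
      = αX (a 0) * αY (b 0) / αZ (f (a 0))
        * (∏ i : Fin k,
            Rmat PX PY PZ f g ⟨(a i.castSucc, b i.castSucc), hΔ i.castSucc⟩
              ⟨(a i.succ, b i.succ), hΔ i.succ⟩)
        * phim (Rmat PX PY PZ f g) (m - k)
            ⟨(a (Fin.last k), b (Fin.last k)), hΔ (Fin.last k)⟩ := by
  obtain ⟨n, rfl⟩ := Nat.exists_eq_add_of_le hmk
  rw [Nat.add_sub_cancel_left]
  exact couplingCyl_eq hX hY hZ hfX hgY n (fun i => ⟨(a i, b i), hΔ i⟩) hc0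
end

section
/- In the standing setup, for every (a,b) ∈ Δ the sequence φ_m(a,b) = (R^m 1_Δ)(a,b) converges to a finite limit as m → ∞. -/
open MeasureTheory Filter Topology
open scoped ENNReal Classical

/-- The sum of `F` over all words of length `m` in the alphabet `C`. -/
noncomputable def wordSum {C : Type*} : ℕ → (List C → ℝ≥0∞) → ℝ≥0∞
  | 0, F => F []
  | m + 1, F => ∑' c, wordSum m (fun w => F (c :: w))

/-- The probability that the `f`-image of the chain with transition matrix `P` started from `u`
reads the word `w` after time `0`. -/
noncomputable def wordProb {U C : Type*} (f : U → C) (P : U → U → ℝ≥0∞) : U → List C → ℝ≥0∞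
  | _, [] => 1
  | u, c :: w => ∑' u', if f u' = c then P u u' * wordProb f P u' w else 0

/-- The trajectories whose `f`-image reads the word `w` right after time `k`. -/
def readsAfter {U C : Type*} (f : U → C) : List C → ℕ → Set (ℕ → U)
  | [], _ => Set.univ
  | c :: w, k => {ω | f (ω (k + 1)) = c} ∩ readsAfter f w (k + 1)

section WordSum

variable {C : Type*}

theorem wordSum_snoc (m : ℕ) (F : List C → ℝ≥0∞) :
    wordSum (m + 1) F = wordSum m (fun w => ∑' c, F (w ++ [c])) := by
  induction m generalizing F with
  | zero => rfl
  | succ m ih =>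
    exact tsum_congr fun c => ih _

theorem wordSum_mono (m : ℕ) {F G : List C → ℝ≥0∞} (h : ∀ w, F w ≤ G w) :
    wordSum m F ≤ wordSum m G := by
  induction m generalizing F G with
  | zero => exact h _
  | succ m ih => exact ENNReal.tsum_le_tsum fun c => ih fun w => h _

theorem wordSum_add (m : ℕ) (F G : List C → ℝ≥0∞) :
    wordSum m (fun w => F w + G w) = wordSum m F + wordSum m G := by
  induction m generalizing F G with
  | zero => rfl
  | succ m ih => simp only [wordSum, ih, ENNReal.tsum_add]

theorem wordSum_const_mul (m : ℕ) (r : ℝ≥0∞) (F : List C → ℝ≥0∞) :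
    wordSum m (fun w => r * F w) = r * wordSum m F := by
  induction m generalizing F with
  | zero => rfl
  | succ m ih => simp only [wordSum, ih, ENNReal.tsum_mul_left]

theorem wordSum_tsum {ι : Type*} (m : ℕ) (F : ι → List C → ℝ≥0∞) :
    wordSum m (fun w => ∑' i, F i w) = ∑' i, wordSum m (F i) := by
  induction m generalizing F with
  | zero => rfl
  | succ m ih =>
    simp only [wordSum, ih]
    exact ENNReal.tsum_comm

theorem wordSum_eq_of_consistent {x : List C → ℝ≥0∞} (hx : ∀ w, ∑' c, x (w ++ [c]) = x w)
    (m : ℕ) : wordSum m x = x [] := by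
  induction m with
  | zero => rfl
  | succ m ih => simp only [wordSum_snoc, hx, ih]

end WordSum

section WordProb

variable {U C : Type*} {f : U → C} {P : U → U → ℝ≥0∞}

theorem tsum_ite_fiber (F : U → ℝ≥0∞) :
    ∑' c, ∑' u, (if f u = c then F u else 0) = ∑' u, F u := by
  rw [ENNReal.tsum_comm]
  exact tsum_congr fun u => tsum_ite_eq' (f u) fun _ => F u

theorem wordProb_consistent (hP : IsStochastic P) (u : U) (w : List C) :
    ∑' c, wordProb f P u (w ++ [c]) = wordProb f P u w := by
  induction w generalizing u with
  | nil =>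
    simp only [List.nil_append, wordProb, mul_one]
    rw [tsum_ite_fiber, hP u]
  | cons c' w ih =>
    simp only [List.cons_append, wordProb]
    rw [ENNReal.tsum_comm]
    refine tsum_congr fun u' => ?_
    split_ifs with h
    · rw [ENNReal.tsum_mul_left, ih]
    · simp

theorem wordProb_le_one (hP : IsStochastic P) (u : U) (w : List C) : wordProb f P u w ≤ 1 := by
  induction w generalizing u with
  | nil => rfl
  | cons c w ih =>
    rw [← hP u]
    refine ENNReal.tsum_le_tsum fun u' => ?_
    split_ifs
    · exact mul_le_of_le_one_right' (ih u')
    · exact zero_le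

theorem wordProb_id_cons (P : C → C → ℝ≥0∞) (c c' : C) (w : List C) :
    wordProb id P c (c' :: w) = P c c' * wordProb id P c' w := by
  simp only [wordProb, id]
  exact tsum_ite_eq c' _

end WordProb

section Markov

variable {U C : Type*} [MeasurableSpace U]

theorem measurableSet_readsAfter [Countable U] [MeasurableSingletonClass U] (f : U → C)
    (w : List C) (k : ℕ) : MeasurableSet (readsAfter f w k) := by
  induction w generalizing k with
  | nil => exact MeasurableSet.univ
  | cons c w ih =>
    exact ((Set.to_countable {u | f u = c}).measurableSet.preimage
      (measurable_pi_apply (k + 1))).inter (ih _)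

theorem measurableSet_cylinder [MeasurableSingletonClass U] (k : ℕ) (e : ℕ → U) :
    MeasurableSet {ω : ℕ → U | ∀ i ≤ k, ω i = e i} := by
  have : {ω : ℕ → U | ∀ i ≤ k, ω i = e i} = ⋂ i, ⋂ (_ : i ≤ k), (fun ω => ω i) ⁻¹' {e i} := by
    ext; simp
  rw [this]
  exact .iInter fun i => .iInter fun _ => measurable_pi_apply i (measurableSet_singleton _)

theorem IsMarkovChain.measure_cylinder_inter_readsAfter
    [Countable U] [MeasurableSingletonClass U]
    {v : U → ℝ≥0∞} {P : U → U → ℝ≥0∞} {μ : Measure (ℕ → U)}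
    (h : IsMarkovChain v P μ) (f : U → C) (w : List C) (k : ℕ) (e : ℕ → U) :
    μ ({ω | ∀ i ≤ k, ω i = e i} ∩ readsAfter f w k) =
      μ {ω | ∀ i ≤ k, ω i = e i} * wordProb f P (e k) w := by
  induction w generalizing k e with
  | nil => simp [readsAfter, wordProb]
  | cons c w ih =>
    set E : U → Set (ℕ → U) := fun u =>
      {ω | ∀ i ≤ k + 1, ω i = Function.update e (k + 1) u i} with hE
    have memE : ∀ u ω, ω ∈ E u ↔ (∀ i ≤ k, ω i = e i) ∧ ω (k + 1) = u := by
      intro u ω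
      simp only [hE, Set.mem_ofPred_eq]
      constructor
      · refine fun hω => ⟨fun i hi => ?_, by simpa using hω (k + 1) le_rfl⟩
        rw [hω i (by omega), Function.update_of_ne (by omega)]
      · rintro ⟨h1, h2⟩ i hi
        rcases Nat.le_succ_iff.mp hi with hi | rfl
        · rw [Function.update_of_ne (by omega), h1 i hi]
        · simpa using h2
    have muE : ∀ u, μ (E u) = μ {ω | ∀ i ≤ k, ω i = e i} * P (e k) u := by
      intro u
      simp only [hE]
      rw [h.2.2.2, h.2.2.2, Finset.prod_range_succ, ← mul_assoc]
      congr 1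
      · congr 1
        refine Finset.prod_congr rfl fun i hi => ?_
        have := Finset.mem_range.mp hi
        rw [Function.update_of_ne (by omega), Function.update_of_ne (by omega)]
      · simp
    have hsplit : {ω | ∀ i ≤ k, ω i = e i} ∩ readsAfter f (c :: w) k =
        ⋃ u, if f u = c then E u ∩ readsAfter f w (k + 1) else ∅ := by
      ext ω
      simp only [readsAfter, Set.mem_inter_iff, Set.mem_ofPred_eq, Set.mem_iUnion]
      constructor
      · rintro ⟨h1, h2, h3⟩
        refine ⟨ω (k + 1), ?_⟩
        rw [if_pos h2]
        exact ⟨(memE _ _).2 ⟨h1, rfl⟩, h3⟩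
      · rintro ⟨u, hu⟩
        split_ifs at hu with hc
        · obtain ⟨h1, h2⟩ := (memE _ _).1 hu.1
          exact ⟨h1, by rw [h2, hc], hu.2⟩
        · exact hu.elim
    rw [hsplit, measure_iUnion, wordProb, ← ENNReal.tsum_mul_left]
    · refine tsum_congr fun u => ?_
      split_ifs with hc
      · simp only [hE]
        rw [ih, ← mul_assoc, ← muE]
        simp [hE]
      · simp
    · intro u u' huu
      refine Set.disjoint_left.2 fun ω h1 h2 => huu ?_
      dsimp only at h1 h2
      split_ifs at h1 h2
      · rw [← ((memE _ _).1 h1.1).2, ← ((memE _ _).1 h2.1).2]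
      all_goals simp_all
    · intro u
      split_ifs
      · exact (measurableSet_cylinder _ _).inter (measurableSet_readsAfter _ _ _)
      · exact MeasurableSet.empty

theorem exists_cylinder_ne_zero [Countable U] {μ : Measure (ℕ → U)} {t : ℕ} {u : U}
    (h : μ {ω | ω t = u} ≠ 0) :
    ∃ e : ℕ → U, e t = u ∧ μ {ω | ∀ i ≤ t, ω i = e i} ≠ 0 := by
  by_contra! hcon
  refine h (measure_mono_null (t := ⋃ s : Fin (t + 1) → U,
    if s (Fin.last t) = u then {ω | ∀ i ≤ t, ω i = s (Fin.ofNat (t + 1) i)} else ∅) ?_ ?_)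
  · intro ω hω
    refine Set.mem_iUnion.2 ⟨fun i => ω i, ?_⟩
    rw [if_pos (by simpa using hω)]
    intro i hi
    simp [Nat.mod_eq_of_lt (Nat.lt_succ_of_le hi)]
  · refine measure_iUnion_null fun s => ?_
    split_ifs with hs
    · refine hcon (fun i => s (Fin.ofNat (t + 1) i)) ?_
      rw [← hs]
      congr 1
      ext
      simp
    · simp

/-- The word probabilities of a lumped chain are dominated by those of its Markovian image. -/
theorem exists_wordProb_le [Countable U] [MeasurableSingletonClass U] [Countable C] [MeasurableSpace C]
    [MeasurableSingletonClass C] {v : U → ℝ≥0∞} {P : U → U → ℝ≥0∞} {μ : Measure (ℕ → U)}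
    {vZ : C → ℝ≥0∞} {PZ : C → C → ℝ≥0∞} {μZ : Measure (ℕ → C)} {f : U → C}
    (h : IsMarkovChain v P μ) (hZ : IsMarkovChain vZ PZ μZ)
    (hf : μ.map (fun ω n => f (ω n)) = μZ) {t : ℕ} {u : U} (hu : μ {ω | ω t = u} ≠ 0) :
    ∃ K : ℝ≥0∞, K ≠ ⊤ ∧ ∀ w, wordProb f P u w ≤ K * wordProb id PZ (f u) w := by
  obtain ⟨e, rfl, he⟩ := exists_cylinder_ne_zero hu
  have := h.1
  have := hZ.1
  refine ⟨(μ {ω | ∀ i ≤ t, ω i = e i})⁻¹, ENNReal.inv_ne_top.2 he, fun w => ?_⟩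
  have hfm : Measurable (fun (ω : ℕ → U) n => f (ω n)) :=
    measurable_pi_lambda _ fun n => (measurable_of_countable f).comp (measurable_pi_apply n)
  have hreads : ∀ (w : List C) k (ω : ℕ → U), ω ∈ readsAfter f w k →
      (fun n => f (ω n)) ∈ readsAfter id w k := by
    intro w
    induction w with
    | nil => intros; trivial
    | cons c w ih => exact fun k ω hω => ⟨hω.1, ih _ _ hω.2⟩
  have key : μ {ω | ∀ i ≤ t, ω i = e i} * wordProb f P (e t) w ≤ wordProb id PZ (f (e t)) w := by
    calc _ = μ ({ω | ∀ i ≤ t, ω i = e i} ∩ readsAfter f w t) :=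
          (h.measure_cylinder_inter_readsAfter f w t e).symm
      _ ≤ μ ((fun ω n => f (ω n)) ⁻¹' ({ω | ∀ i ≤ t, ω i = f (e i)} ∩ readsAfter id w t)) :=
          measure_mono fun ω hω => ⟨fun i hi => congrArg f (hω.1 i hi), hreads _ _ _ hω.2⟩
      _ = μZ ({ω | ∀ i ≤ t, ω i = f (e i)} ∩ readsAfter id w t) := by
          rw [← hf, Measure.map_apply hfm
            ((measurableSet_cylinder t fun i => f (e i)).inter (measurableSet_readsAfter _ _ _))]
      _ = μZ {ω | ∀ i ≤ t, ω i = f (e i)} * wordProb id PZ (f (e t)) w :=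
          hZ.measure_cylinder_inter_readsAfter id w t fun i => f (e i)
      _ ≤ _ := mul_le_of_le_one_left' prob_le_one
  rw [mul_comm, ← div_eq_mul_inv, ENNReal.le_div_iff_mul_le (.inl he) (.inl (measure_ne_top _ _)),
    mul_comm]
  exact key

end Markov

theorem ENNReal.two_mul_mul_le_sq_add_sq (s t : ℝ≥0∞) : 2 * (s * t) ≤ s * s + t * t := by
  wlog hst : s ≤ t generalizing s t
  · rw [mul_comm s t, add_comm]
    exact this t s (le_of_not_ge hst)
  obtain ⟨r, rfl⟩ := exists_add_of_le hst
  calc 2 * (s * (s + r)) ≤ 2 * (s * (s + r)) + r * r := le_self_add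
    _ = _ := by ring

/-- Sedrakyan's form of the Cauchy–Schwarz inequality. -/
theorem ENNReal.mul_self_div_tsum_le {ι : Type*} {x z : ι → ℝ≥0∞} {K : ℝ≥0∞} (hK : K ≠ ⊤)
    (hz : ∑' i, z i ≠ ⊤) (hxz : ∀ i, x i ≤ K * z i) :
    (∑' i, x i) * (∑' i, x i) / ∑' i, z i ≤ ∑' i, x i * x i / z i := by
  rcases eq_or_ne (∑' i, z i) 0 with h0 | h0
  · have : ∑' i, x i = 0 := by
      refine ENNReal.tsum_eq_zero.2 fun i => le_antisymm ((hxz i).trans ?_) zero_le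
      rw [ENNReal.tsum_eq_zero.1 h0 i, mul_zero]
    simp [this]
  set X := ∑' i, x i with hX
  set Z := ∑' i, z i with hZ
  have hXt : X ≠ ⊤ := by
    refine ne_top_of_le_ne_top (ENNReal.mul_ne_top hK hz) ?_
    rw [hZ, ← ENNReal.tsum_mul_left]
    exact ENNReal.tsum_le_tsum hxz
  set t := X / Z with ht
  have htZ : t * Z = X := ENNReal.div_mul_cancel h0 hz
  have htt : t ≠ ⊤ := ENNReal.div_ne_top hXt h0
  have hpt : ∀ i, 2 * (t * x i) ≤ x i * x i / z i + t * t * z i := by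
    intro i
    rcases eq_or_ne (z i) 0 with hi | hi
    · have : x i = 0 := le_antisymm ((hxz i).trans (by simp [hi])) zero_le
      simp [this]
    have hit : z i ≠ ⊤ := ENNReal.ne_top_of_tsum_ne_top hz i
    obtain ⟨r, hr⟩ : ∃ r, x i = r * z i := ⟨x i / z i, (ENNReal.div_mul_cancel hi hit).symm⟩
    have : x i * x i / z i = r * r * z i := by
      rw [hr, show r * z i * (r * z i) = r * r * z i * z i by ring,
        ENNReal.mul_div_cancel_right hi hit]
    rw [this, hr, ← add_mul, show 2 * (t * (r * z i)) = 2 * (r * t) * z i by ring]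
    gcongr
    exact ENNReal.two_mul_mul_le_sq_add_sq r t
  have hsum := ENNReal.tsum_le_tsum hpt
  rw [ENNReal.tsum_mul_left, ENNReal.tsum_mul_left, ENNReal.tsum_add, ENNReal.tsum_mul_left,
    ← hX, ← hZ, mul_assoc, htZ, two_mul] at hsum
  rw [show X * X / Z = t * X by rw [ht, div_eq_mul_inv, div_eq_mul_inv]; ring]
  exact ENNReal.le_of_add_le_add_right (ENNReal.mul_ne_top htt hXt) hsum

section Polarization

variable {C : Type*} {x y z : List C → ℝ≥0∞} {K K' : ℝ≥0∞}

theorem wordSum_mul_div_le (hxc : ∀ w, ∑' c, x (w ++ [c]) = x w) (hyz : ∀ w, y w ≤ K * z w)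
    (m : ℕ) : wordSum m (fun w => x w * y w / z w) ≤ K * x [] := by
  rw [← wordSum_eq_of_consistent hxc m, ← wordSum_const_mul]
  refine wordSum_mono m fun w => ?_
  calc x w * y w / z w ≤ x w * (K * z w) / z w := by gcongr; exact hyz w
    _ = K * x w * (z w / z w) := by rw [div_eq_mul_inv, div_eq_mul_inv]; ring
    _ ≤ K * x w := mul_le_of_le_one_right' ENNReal.div_self_le_one

theorem monotone_wordSum_mul_self_div (hK : K ≠ ⊤) (hz : ∀ w, z w ≠ ⊤)
    (hzc : ∀ w, ∑' c, z (w ++ [c]) = z w) (hxc : ∀ w, ∑' c, x (w ++ [c]) = x w)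
    (hxz : ∀ w, x w ≤ K * z w) :
    Monotone fun m => wordSum m (fun w => x w * x w / z w) := by
  refine monotone_nat_of_le_succ fun m => ?_
  rw [wordSum_snoc]
  refine wordSum_mono m fun w => ?_
  rw [← hxc w, ← hzc w]
  exact ENNReal.mul_self_div_tsum_le hK (by rw [hzc]; exact hz w) fun c => hxz _

theorem exists_tendsto_wordSum_mul_self_div (hK : K ≠ ⊤) (hz : ∀ w, z w ≠ ⊤)
    (hzc : ∀ w, ∑' c, z (w ++ [c]) = z w) (hxc : ∀ w, ∑' c, x (w ++ [c]) = x w)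
    (hxz : ∀ w, x w ≤ K * z w) :
    ∃ L : ℝ≥0∞, L ≠ ⊤ ∧
      Tendsto (fun m => wordSum m (fun w => x w * x w / z w)) atTop (𝓝 L) := by
  refine ⟨_, ?_, tendsto_atTop_iSup (monotone_wordSum_mul_self_div hK hz hzc hxc hxz)⟩
  refine ne_top_of_le_ne_top (ENNReal.mul_ne_top hK (ENNReal.mul_ne_top hK (hz [])))
    (iSup_le fun m => (wordSum_mul_div_le hxc hxz m).trans ?_)
  gcongr
  exact hxz []

theorem exists_tendsto_wordSum_mul_div (hK : K ≠ ⊤) (hK' : K' ≠ ⊤) (hz : ∀ w, z w ≠ ⊤)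
    (hzc : ∀ w, ∑' c, z (w ++ [c]) = z w) (hxc : ∀ w, ∑' c, x (w ++ [c]) = x w)
    (hyc : ∀ w, ∑' c, y (w ++ [c]) = y w)
    (hxz : ∀ w, x w ≤ K * z w) (hyz : ∀ w, y w ≤ K' * z w) :
    ∃ L : ℝ≥0∞, L ≠ ⊤ ∧
      Tendsto (fun m => wordSum m (fun w => x w * y w / z w)) atTop (𝓝 L) := by
  obtain ⟨Lx, hLx, hx⟩ := exists_tendsto_wordSum_mul_self_div hK hz hzc hxc hxz
  obtain ⟨Ly, hLy, hy⟩ := exists_tendsto_wordSum_mul_self_div hK' hz hzc hyc hyz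
  obtain ⟨Ls, hLs, hs⟩ := exists_tendsto_wordSum_mul_self_div (x := fun w => x w + y w)
    (ENNReal.add_ne_top.2 ⟨hK, hK'⟩) hz hzc
    (fun w => by rw [ENNReal.tsum_add, hxc, hyc])
    (fun w => by rw [add_mul]; exact add_le_add (hxz w) (hyz w))
  have hfin : ∀ {u : List C → ℝ≥0∞} {M : ℝ≥0∞}, M ≠ ⊤ → (∀ w, ∑' c, u (w ++ [c]) = u w) →
      (∀ w, u w ≤ M * z w) → ∀ m, wordSum m (fun w => u w * u w / z w) ≠ ⊤ :=
    fun hM huc huz m => ne_top_of_le_ne_top (ENNReal.mul_ne_top hM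
      (ne_top_of_le_ne_top (ENNReal.mul_ne_top hM (hz [])) (huz [])))
      (wordSum_mul_div_le huc huz m)
  have hpol : ∀ m, wordSum m (fun w => (x w + y w) * (x w + y w) / z w) =
      2 * wordSum m (fun w => x w * y w / z w) + (wordSum m (fun w => x w * x w / z w) +
        wordSum m (fun w => y w * y w / z w)) := by
    intro m
    rw [← wordSum_const_mul, ← wordSum_add, ← wordSum_add]
    congr 1
    funext w
    simp only [div_eq_mul_inv]
    ring
  have heq : ∀ m, wordSum m (fun w => x w * y w / z w) =
      (wordSum m (fun w => (x w + y w) * (x w + y w) / z w) -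
        (wordSum m (fun w => x w * x w / z w) + wordSum m (fun w => y w * y w / z w))) / 2 := by
    intro m
    rw [hpol, ENNReal.add_sub_cancel_right
      (ENNReal.add_ne_top.2 ⟨hfin hK hxc hxz m, hfin hK' hyc hyz m⟩), mul_comm,
      ENNReal.mul_div_cancel_right two_ne_zero ENNReal.ofNat_ne_top]
  refine ⟨(Ls - (Lx + Ly)) / 2, ENNReal.div_ne_top (ENNReal.sub_ne_top hLs) two_ne_zero, ?_⟩
  simp_rw [heq]
  exact ENNReal.Tendsto.div_const (ENNReal.Tendsto.sub hs (hx.add hy) (.inl hLs))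
    (.inr two_ne_zero)

end Polarization

theorem phim_Rmat_eq_wordSum {A B C : Type*} {PX : A → A → ℝ≥0∞} {PY : B → B → ℝ≥0∞}
    {PZ : C → C → ℝ≥0∞} {f : A → C} {g : B → C} (hPZ : IsStochastic PZ)
    (hsupp : ∀ a a', PZ (f a) (f a') = 0 → PX a a' = 0) (m : ℕ) (d : Delta f g) :
    phim (Rmat PX PY PZ f g) m d = wordSum m (fun w =>
      wordProb f PX d.1.1 w * wordProb g PY d.1.2 w / wordProb id PZ (f d.1.1) w) := by
  induction m generalizing d with
  | zero => simp [phim, wordSum, wordProb]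
  | succ m ih =>
    obtain ⟨⟨a, b⟩, hab⟩ := d
    have hterm : ∀ (a' : A) (b' : B) (c : C), f a' = c → g b' = c →
        wordSum m (fun w => PX a a' * wordProb f PX a' w * (PY b b' * wordProb g PY b' w) /
          wordProb id PZ (f a) (c :: w)) =
        (if PZ (f a) c ≠ 0 then PX a a' * PY b b' / PZ (f a) c else 0) *
          wordSum m (fun w =>
            wordProb f PX a' w * wordProb g PY b' w / wordProb id PZ c w) := by
      rintro a' b' _ rfl -
      rw [← wordSum_const_mul]
      congr 1
      funext w
      split_ifs with h
      · have h1 : PZ (f a) (f a') ≠ ⊤ := ENNReal.ne_top_of_tsum_ne_top (by simp [hPZ (f a)]) _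
        have h2 : wordProb id PZ (f a') w ≠ ⊤ :=
          ne_top_of_le_ne_top ENNReal.one_ne_top (wordProb_le_one hPZ _ _)
        rw [wordProb_id_cons]
        simp only [div_eq_mul_inv]
        rw [ENNReal.mul_inv (.inl h) (.inl h1)]
        ring
      · simp [hsupp a a' (not_not.1 h)]
    have hcons : ∀ (c : C) (w : List C),
        wordProb f PX a (c :: w) * wordProb g PY b (c :: w) / wordProb id PZ (f a) (c :: w) =
        ∑' a', ∑' b', if f a' = c ∧ g b' = c then
          PX a a' * wordProb f PX a' w * (PY b b' * wordProb g PY b' w) /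
            wordProb id PZ (f a) (c :: w) else 0 := by
      intro c w
      conv_lhs => rw [div_eq_mul_inv, wordProb, wordProb]
      simp_rw [← ENNReal.tsum_mul_right, ← ENNReal.tsum_mul_left, ← ENNReal.tsum_mul_right]
      refine tsum_congr fun a' => tsum_congr fun b' => ?_
      by_cases h1 : f a' = c <;> by_cases h2 : g b' = c <;> simp [h1, h2, div_eq_mul_inv]
    simp only [phim, wordSum, ih, hcons, wordSum_tsum]
    have hL : ∀ F : A × B → ℝ≥0∞,
        ∑' e : Delta f g, F e.1 = ∑' a', ∑' b', if f a' = g b' then F (a', b') else 0 := by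
      intro F
      rw [← ENNReal.tsum_prod]
      refine (tsum_subtype {p : A × B | f p.1 = g p.2} F).trans ?_
      exact tsum_congr fun p => by simp [Set.indicator_apply]
    refine (hL fun e => (if PZ (f a) (f e.1) ≠ 0 then
      PX a e.1 * PY b e.2 / PZ (f a) (f e.1) else 0) * wordSum m (fun w =>
        wordProb f PX e.1 w * wordProb g PY e.2 w / wordProb id PZ (f e.1) w)).trans ?_
    rw [ENNReal.tsum_comm (α := C)]
    refine tsum_congr fun a' => ?_
    rw [ENNReal.tsum_comm (α := C)]
    refine tsum_congr fun b' => ?_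
    rw [tsum_eq_single (f a')]
    · by_cases h : f a' = g b'
      · simp only [h.symm, and_self, if_true]
        exact (hterm a' b' _ rfl h.symm).symm
      · simp only [h, Ne.symm h, and_false, if_false]
        simpa using (wordSum_const_mul m 0 fun _ : List C => 0).symm
    · intro c hc
      simp only [hc.symm, false_and, if_false]
      simpa using wordSum_const_mul m 0 fun _ : List C => 0

/-- **Convergence of `φ_m`.** In the standing setup, for every `(a,b) ∈ Δ` the sequence
`φ_m(a,b) = (R^m 1_Δ)(a,b)`, computed in `[0,∞]`, converges to a finite limit as `m → ∞`. -/
theorem statement_10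
    {A B C : Type*} [Countable A] [Countable B] [Countable C]
    [MeasurableSpace A] [MeasurableSingletonClass A]
    [MeasurableSpace B] [MeasurableSingletonClass B]
    [MeasurableSpace C] [MeasurableSingletonClass C]
    (αX : A → ℝ≥0∞) (PX : A → A → ℝ≥0∞) (μX : Measure (ℕ → A))
    (αY : B → ℝ≥0∞) (PY : B → B → ℝ≥0∞) (μY : Measure (ℕ → B))
    (αZ : C → ℝ≥0∞) (PZ : C → C → ℝ≥0∞) (μZ : Measure (ℕ → C))
    (f : A → C) (g : B → C)
    (hX : IsMarkovChain αX PX μX) (hY : IsMarkovChain αY PY μY)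
    (hZ : IsMarkovChain αZ PZ μZ)
    (hfX : μX.map (fun ω n => f (ω n)) = μZ)
    (hgY : μY.map (fun ω n => g (ω n)) = μZ)
    (hAvis : ∀ a : A, ∃ t : ℕ, μX {ω | ω t = a} ≠ 0)
    (hBvis : ∀ b : B, ∃ t : ℕ, μY {ω | ω t = b} ≠ 0) :
    ∀ d : Delta f g, ∃ L : ℝ≥0∞, L ≠ ⊤ ∧
      Tendsto (fun m => phim (Rmat PX PY PZ f g) m d) atTop (𝓝 L) := by
  intro d
  obtain ⟨⟨a, b⟩, hab⟩ := d
  have hdomX := fun a => (hAvis a).elim fun _ ht => exists_wordProb_le hX hZ hfX ht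
  have hsupp : ∀ a a', PZ (f a) (f a') = 0 → PX a a' = 0 := by
    intro a a' h
    obtain ⟨K, -, hK⟩ := hdomX a
    have h0 : wordProb f PX a [f a'] ≤ 0 := by
      simpa [wordProb_id_cons, h] using hK [f a']
    have hle : PX a a' ≤ wordProb f PX a [f a'] := by
      refine le_trans ?_ (ENNReal.le_tsum a')
      simp [wordProb]
    exact le_antisymm (hle.trans h0) zero_le
  obtain ⟨K, hK, hKw⟩ := hdomX a
  obtain ⟨t, ht⟩ := hBvis b
  obtain ⟨K', hK', hKw'⟩ := exists_wordProb_le hY hZ hgY ht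
  simp only at hab
  rw [← hab] at hKw'
  simp_rw [phim_Rmat_eq_wordSum hZ.2.2.1 hsupp]
  exact exists_tendsto_wordSum_mul_div hK hK'
    (fun w => ne_top_of_le_ne_top ENNReal.one_ne_top (wordProb_le_one hZ.2.2.1 _ _))
    (wordProb_consistent hZ.2.2.1 _) (wordProb_consistent hX.2.2.1 a)
    (wordProb_consistent hY.2.2.1 b) hKw hKw'
end

section
/- Let A = B = {1,2,3,4}, C = {0,1}, f(2) = 0 and f(i) = 1 for i ≠ 2, g(1) = 0 and g(j) = 1 for j ≠ 1. Let P_X be the stochastic matrix on {1,2,3,4} with nonzero entries P_X(1,2)=1, P_X(2,1)=1/3, P_X(2,3)=2/3, P_X(3,2)=1/4, P_X(3,4)=3/4, P_X(4,3)=1, and P_Y the stochastic matrix with nonzero entries P_Y(1,2)=1, P_Y(2,1)=1/2, P_Y(2,3)=1/2, P_Y(3,2)=1/2, P_Y(3,4)=1/2, P_Y(4,3)=1. Let X̄ = MC(δ_2, P_X) and Ȳ = MC(δ_1, P_Y). Then f(X̄) =ᵈ g(Ȳ), but there does not exist any Markov chain (W_t)_{t≥0} = (X_t,Y_t)_{t≥0},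 even a time-inhomogeneous one, taking values in Δ(f,g) = {(a,b) : f(a) = g(b)} such that (X_t)_{t≥0} =ᵈ X̄ and (Y_t)_{t≥0} =ᵈ Ȳ. -/
open MeasureTheory Filter Topology
open scoped ENNReal Classical

/-- `μ` is the law of the (possibly time-inhomogeneous) Markov chain `MC(v,(P_t)_{t ≥ 1})`. -/
def IsInhomMarkovChain {U : Type*} [MeasurableSpace U]
    (v : U → ℝ≥0∞) (P : ℕ → U → U → ℝ≥0∞) (μ : Measure (ℕ → U)) : Prop :=
  IsProbabilityMeasure μ ∧ IsProbVec v ∧ (∀ t, IsStochastic (P t)) ∧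
    ∀ (k : ℕ) (a : ℕ → U),
      μ {ω | ∀ i ≤ k, ω i = a i} = v (a 0) * ∏ i ∈ Finset.range k, P (i + 1) (a i) (a (i + 1))

/-- The transition matrix of `X̄` in the bat-cave example; states `0,1,2,3` stand for the
paper's states `1,2,3,4`. -/
noncomputable def PXmat : Fin 4 → Fin 4 → ℝ≥0∞ :=
  ![![0, 1, 0, 0], ![1/3, 0, 2/3, 0], ![0, 1/4, 0, 3/4], ![0, 0, 1, 0]]

/-- The transition matrix of `Ȳ` in the bat-cave example. -/
noncomputable def PYmat : Fin 4 → Fin 4 → ℝ≥0∞ :=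
  ![![0, 1, 0, 0], ![1/2, 0, 1/2, 0], ![0, 1/2, 0, 1/2], ![0, 0, 1, 0]]

/-- `f`: the paper's state `2` (index `1`) maps to `0`, all other states map to `1`. -/
def fmap : Fin 4 → Fin 2 := fun a => if a = 1 then 0 else 1

/-- `g`: the paper's state `1` (index `0`) maps to `0`, all other states map to `1`. -/
def gmap : Fin 4 → Fin 2 := fun b => if b = 0 then 0 else 1

open ProbabilityTheory

section PathSpace

variable {U : Type*} [MeasurableSpace U]
  {v : U → ℝ≥0∞} {P : U → U → ℝ≥0∞} {μ : Measure (ℕ → U)}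

theorem IsMarkovChain.measure_zero_eq (hμ : IsMarkovChain v P μ) (x : U) :
    μ {ω | ω 0 = x} = v x := by
  simpa using hμ.2.2.2 0 fun _ => x

variable {V : Type*}

/-- The probability that the image of the path under `h` starts with the first `k + 1` letters
of `a` while the path itself is at `x` at time `k`. -/
noncomputable def forwardProb (μ : Measure (ℕ → U)) (h : U → V) (a : ℕ → V) (k : ℕ) (x : U) : ℝ :=
  μ.real {ω | (∀ i ≤ k, h (ω i) = a i) ∧ ω k = x}

theorem IsMarkovChain.forwardProb_zero (hμ : IsMarkovChain v P μ) (h : U → V) (a : ℕ → V)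
    (x : U) : forwardProb μ h a 0 x = if h x = a 0 then (v x).toReal else 0 := by
  unfold forwardProb
  split_ifs with hx
  · rw [← hμ.measure_zero_eq, measureReal_def]
    congr 2
    ext ω
    simp only [Nat.le_zero, forall_eq, Set.mem_ofPred_eq, and_iff_right_iff_imp]
    rintro rfl
    exact hx
  · convert measureReal_empty (μ := μ)
    refine Set.eq_empty_of_forall_notMem ?_
    rintro ω ⟨h', rfl⟩
    exact hx (h' 0 le_rfl)

variable [Fintype U]

/-- Almost surely, a Markov chain starts at a state of positive mass. -/
theorem IsMarkovChain.ae_init_ne_zero (hμ : IsMarkovChain v P μ) : ∀ᵐ ω ∂μ, v (ω 0) ≠ 0 := by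
  have h : ∀ x, ∀ᵐ ω ∂μ, ω 0 = x → v x ≠ 0 := fun x => by
    by_cases hx : v x = 0
    · have : μ {ω | ω 0 = x} = 0 := by rw [hμ.measure_zero_eq, hx]
      filter_upwards [measure_eq_zero_iff_ae_notMem.1 this] with ω hω h using absurd h hω
    · exact ae_of_all _ fun _ _ => hx
  filter_upwards [ae_all_iff.2 h] with ω hω using hω _ rfl

variable [DiscreteMeasurableSpace U]

/-- Finite measures on path space are determined by the probabilities of finite words. -/
theorem ext_of_finite_words {μ ν : Measure (ℕ → U)} [IsFiniteMeasure μ] [IsFiniteMeasure ν]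
    (h : ∀ (k : ℕ) (a : ℕ → U), μ {ω | ∀ i ≤ k, ω i = a i} = ν {ω | ∀ i ≤ k, ω i = a i}) :
    μ = ν := by
  have hproj : IsProjectiveMeasureFamily (fun I : Finset ℕ => μ.map I.restrict) :=
    isProjectiveMeasureFamily_map_restrict (X := fun n (ω : ℕ → U) => ω n)
      fun t => (measurable_pi_apply t).aemeasurable
  have hμ : IsProjectiveLimit μ (fun I : Finset ℕ => μ.map I.restrict) := fun _ => rfl
  have hν : IsProjectiveLimit ν (fun I : Finset ℕ => μ.map I.restrict) := by
    rw [isProjectiveLimit_nat_iff hproj]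
    intro n
    refine Measure.ext_of_singleton fun b => ?_
    rw [Measure.map_apply (Preorder.measurable_frestrictLe n) (measurableSet_singleton b),
      Measure.map_apply (Finset.measurable_restrict _) (measurableSet_singleton b)]
    set a : ℕ → U := fun i => if hi : i ≤ n then b ⟨i, Finset.mem_Iic.2 hi⟩
      else b ⟨n, Finset.mem_Iic.2 le_rfl⟩ with ha
    have hset : (Finset.Iic n).restrict (π := fun _ : ℕ => U) ⁻¹' {b} = {ω : ℕ → U | ∀ i ≤ n, ω i = a i} := by
      ext ω
      simp only [Set.mem_preimage, Set.mem_singleton_iff, Set.mem_ofPred_eq, funext_iff,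
        Subtype.forall, Finset.mem_Iic, Finset.restrict]
      exact forall₂_congr fun i hi => by simp [ha, hi]
    exact (congrArg ν hset).trans ((h n a).symm.trans (congrArg μ hset).symm)
  exact hμ.unique hν

/-- The Markov property, for an event depending on the first `k + 1` coordinates. -/
theorem IsMarkovChain.measure_inter_step (hμ : IsMarkovChain v P μ) (k : ℕ)
    (E : Set (Finset.Iic k → U)) (x y : U) :
    μ {ω | Preorder.frestrictLe k ω ∈ E ∧ ω k = x ∧ ω (k + 1) = y} =
      P x y * μ {ω | Preorder.frestrictLe k ω ∈ E ∧ ω k = x} := by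
  have hπ := Preorder.measurable_frestrictLe (X := fun _ : ℕ => U) k
  have hE : MeasurableSet E := (Set.toFinite E).measurableSet
  have key : (μ.restrict {ω | ω k = x ∧ ω (k + 1) = y}).map (Preorder.frestrictLe k) =
      P x y • (μ.restrict {ω | ω k = x}).map (Preorder.frestrictLe k) := by
    refine Measure.ext_of_singleton fun b => ?_
    rw [Measure.smul_apply, Measure.map_apply hπ (measurableSet_singleton b),
      Measure.map_apply hπ (measurableSet_singleton b),
      Measure.restrict_apply (hπ (measurableSet_singleton b)),
      Measure.restrict_apply (hπ (measurableSet_singleton b)), smul_eq_mul]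
    by_cases hb : b ⟨k, Finset.mem_Iic.2 le_rfl⟩ = x
    · set a : ℕ → U := fun i => if hi : i ≤ k then b ⟨i, Finset.mem_Iic.2 hi⟩ else y with ha
      have hmem (ω : ℕ → U) : Preorder.frestrictLe k ω = b ↔ ∀ i ≤ k, ω i = a i := by
        simp only [funext_iff, Subtype.forall, Finset.mem_Iic, Preorder.frestrictLe_apply]
        exact forall₂_congr fun i hi => by simp [ha, hi]
      have hak : a k = x := by simp [ha, hb]
      have hak' : a (k + 1) = y := by simp [ha]
      have h1 : Preorder.frestrictLe (π := fun _ : ℕ => U) k ⁻¹' {b} ∩ {ω | ω k = x ∧ ω (k + 1) = y} =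
          {ω : ℕ → U | ∀ i ≤ k + 1, ω i = a i} := by
        ext ω
        simp only [Set.mem_inter_iff, Set.mem_preimage, Set.mem_singleton_iff, hmem,
          Set.mem_ofPred_eq]
        constructor
        · rintro ⟨h, -, h'⟩ i hi
          rcases Nat.le_succ_iff.1 hi with hi | rfl
          exacts [h i hi, h'.trans hak'.symm]
        · intro h
          exact ⟨fun i hi => h i (hi.trans (Nat.le_succ k)), (h k (Nat.le_succ k)).trans hak,
            (h _ le_rfl).trans hak'⟩
      have h2 : Preorder.frestrictLe (π := fun _ : ℕ => U) k ⁻¹' {b} ∩ {ω | ω k = x} =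
          {ω : ℕ → U | ∀ i ≤ k, ω i = a i} := by
        ext ω
        simp only [Set.mem_inter_iff, Set.mem_preimage, Set.mem_singleton_iff, hmem,
          Set.mem_ofPred_eq]
        exact ⟨And.left, fun h => ⟨h, (h k le_rfl).trans hak⟩⟩
      rw [h1, h2, hμ.2.2.2, hμ.2.2.2, Finset.prod_range_succ, hak, hak']
      ring
    · have h2 : Preorder.frestrictLe (π := fun _ : ℕ => U) k ⁻¹' {b} ∩ {ω | ω k = x} = (∅ : Set (ℕ → U)) := by
        refine Set.eq_empty_of_forall_notMem ?_
        rintro ω ⟨rfl, rfl⟩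
        exact hb rfl
      rw [h2, measure_empty, mul_zero]
      refine measure_mono_null (fun ω hω => ?_) (measure_empty (μ := μ))
      rw [← h2]
      exact ⟨hω.1, hω.2.1⟩
  have := congrArg (fun m => m E) key
  simp only [Measure.smul_apply, Measure.map_apply hπ hE, Measure.restrict_apply (hπ hE),
    smul_eq_mul] at this
  exact this

/-- Almost surely, a Markov chain only makes transitions of positive probability. -/
theorem IsMarkovChain.ae_step_ne_zero (hμ : IsMarkovChain v P μ) :
    ∀ᵐ ω ∂μ, ∀ k, P (ω k) (ω (k + 1)) ≠ 0 := by
  have h : ∀ k x y, ∀ᵐ ω ∂μ, ω k = x ∧ ω (k + 1) = y → P x y ≠ 0 := fun k x y => by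
    by_cases hx : P x y = 0
    · have : μ {ω | ω k = x ∧ ω (k + 1) = y} = 0 := by
        simpa [hx] using hμ.measure_inter_step k Set.univ x y
      filter_upwards [measure_eq_zero_iff_ae_notMem.1 this] with ω hω h using absurd h hω
    · exact ae_of_all _ fun _ _ => hx
  filter_upwards [ae_all_iff.2 fun k => ae_all_iff.2 fun x => ae_all_iff.2 (h k x)] with ω hω k
    using hω k _ _ ⟨rfl, rfl⟩

theorem sum_measureReal_inter_eq [IsFiniteMeasure μ] (E : Set (ℕ → U)) (k : ℕ) :
    ∑ x, μ.real {ω | ω ∈ E ∧ ω k = x} = μ.real E := by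
  have hm (x : U) : MeasurableSet ((fun ω : ℕ → U => ω k) ⁻¹' {x}) :=
    measurable_pi_apply k (measurableSet_singleton x)
  have h := sum_measure_preimage_singleton (μ := μ.restrict E) Finset.univ fun y _ => hm y
  simp only [Measure.restrict_apply (hm _), Finset.coe_univ, Set.preimage_univ,
    Measure.restrict_apply_univ] at h
  rw [measureReal_def, ← h, ENNReal.toReal_sum fun _ _ => measure_ne_top _ _]
  refine Finset.sum_congr rfl fun x _ => ?_
  rw [measureReal_def, Set.inter_comm]
  rfl

theorem sum_forwardProb [IsFiniteMeasure μ] (h : U → V) (a : ℕ → V) (k : ℕ) :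
    ∑ x, forwardProb μ h a k x = μ.real {ω | ∀ i ≤ k, h (ω i) = a i} :=
  sum_measureReal_inter_eq _ k

theorem IsMarkovChain.forwardProb_succ (hμ : IsMarkovChain v P μ) (h : U → V) (a : ℕ → V)
    (k : ℕ) (y : U) : forwardProb μ h a (k + 1) y =
      if h y = a (k + 1) then ∑ x, (P x y).toReal * forwardProb μ h a k x else 0 := by
  have := hμ.1
  unfold forwardProb
  split_ifs with hy
  · rw [← sum_measureReal_inter_eq _ k]
    refine Finset.sum_congr rfl fun x _ => ?_
    rw [measureReal_def, measureReal_def, ← ENNReal.toReal_mul]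
    congr 1
    have hstep := hμ.measure_inter_step k {b | ∀ i, h (b i) = a i} x y
    simp only [Set.mem_ofPred_eq, Subtype.forall, Finset.mem_Iic,
      Preorder.frestrictLe_apply] at hstep
    rw [← hstep]
    congr 1
    ext ω
    simp only [Set.mem_ofPred_eq]
    constructor
    · rintro ⟨⟨h1, h2⟩, h3⟩
      exact ⟨fun i hi => h1 i (hi.trans (Nat.le_succ k)), h3, h2⟩
    · rintro ⟨h1, h3, h2⟩
      refine ⟨⟨fun i hi => ?_, h2⟩, h3⟩
      rcases Nat.le_succ_iff.1 hi with hi | rfl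
      exacts [h1 i hi, h2.symm ▸ hy]
  · convert measureReal_empty (μ := μ)
    refine Set.eq_empty_of_forall_notMem ?_
    rintro ω ⟨h', rfl⟩
    exact hy (h' _ le_rfl)

end PathSpace

section BatCave

variable {μX μY : Measure (ℕ → Fin 4)}

theorem forwardProb_relation
    (hX : IsMarkovChain (fun a => if a = 1 then 1 else 0) PXmat μX)
    (hY : IsMarkovChain (fun b => if b = 0 then 1 else 0) PYmat μY) (a : ℕ → Fin 2) (k : ℕ) :
    let u := forwardProb μX fmap a k
    let w := forwardProb μY gmap a k
    (u 0 = 0 ∧ u 2 = 0 ∧ w 1 = 0 ∧ w 3 = 0 ∧ u 1 = w 0 ∧ u 3 = w 2) ∨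
      (u 1 = 0 ∧ u 3 = 0 ∧ w 0 = 0 ∧ w 2 = 0 ∧
        u 0 + u 2 / 4 = w 1 / 2 ∧ 3 / 4 * u 2 = w 1 / 2 + w 3) := by
  intro u w
  induction k with
  | zero =>
    left
    simp [u, w, hX.forwardProb_zero, hY.forwardProb_zero, fmap, gmap]
  | succ k ih =>
    simp only [u, w, hX.forwardProb_succ, hY.forwardProb_succ, Fin.sum_univ_four, PXmat, PYmat]
    generalize forwardProb μX fmap a k = u at ih ⊢
    generalize forwardProb μY gmap a k = w at ih ⊢
    generalize a (k + 1) = c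
    rcases ih with ⟨h0, h1, h2, h3, h4, h5⟩ | ⟨h0, h1, h2, h3, h4, h5⟩
    · right
      fin_cases c <;> simp [fmap, gmap, h0, h1, h2, h3, h4, h5]
      constructor <;> ring
    · left
      fin_cases c <;> simp [fmap, gmap, h0, h1, h2, h3] <;> linarith

theorem map_fmap_eq_map_gmap
    (hX : IsMarkovChain (fun a => if a = 1 then 1 else 0) PXmat μX)
    (hY : IsMarkovChain (fun b => if b = 0 then 1 else 0) PYmat μY) :
    μX.map (fun ω n => fmap (ω n)) = μY.map (fun ω n => gmap (ω n)) := by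
  have := hX.1
  have := hY.1
  have hf : Measurable fun (ω : ℕ → Fin 4) n => fmap (ω n) :=
    measurable_pi_lambda _ fun n =>
      (Measurable.of_discrete (f := fmap)).comp (measurable_pi_apply n)
  have hg : Measurable fun (ω : ℕ → Fin 4) n => gmap (ω n) :=
    measurable_pi_lambda _ fun n =>
      (Measurable.of_discrete (f := gmap)).comp (measurable_pi_apply n)
  refine ext_of_finite_words fun k a => ?_
  have hm : MeasurableSet {ω : ℕ → Fin 2 | ∀ i ≤ k, ω i = a i} := by measurability
  rw [Measure.map_apply hf hm, Measure.map_apply hg hm,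
    ← ENNReal.toReal_eq_toReal_iff' (measure_ne_top _ _) (measure_ne_top _ _)]
  refine (sum_forwardProb (μ := μX) fmap a k).symm.trans
    (Eq.trans ?_ (sum_forwardProb (μ := μY) gmap a k))
  simp only [Fin.sum_univ_four]
  rcases forwardProb_relation hX hY a k with h | h <;> linarith

/-- The admissible trajectories of a coupling of the two chains in `Δ(f,g)`. -/
structure IsCouplingPath (ω : ℕ → Fin 4 × Fin 4) : Prop where
  initX : (ω 0).1 = 1
  initY : (ω 0).2 = 0
  stepX : ∀ k, PXmat (ω k).1 (ω (k + 1)).1 ≠ 0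
  stepY : ∀ k, PYmat (ω k).2 (ω (k + 1)).2 ≠ 0
  mem : ∀ k, fmap (ω k).1 = gmap (ω k).2

theorem PXmat_ne_zero_iff (a b : Fin 4) :
    PXmat a b ≠ 0 ↔ a.val + 1 = b.val ∨ b.val + 1 = a.val := by
  fin_cases a <;> fin_cases b <;> simp [PXmat]

theorem PYmat_ne_zero_iff (a b : Fin 4) :
    PYmat a b ≠ 0 ↔ a.val + 1 = b.val ∨ b.val + 1 = a.val := by
  fin_cases a <;> fin_cases b <;> simp [PYmat]

theorem fmap_eq_gmap_iff (a b : Fin 4) : fmap a = gmap b ↔ (a.val = 1 ↔ b.val = 0) := by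
  revert a b
  decide

theorem ae_isCouplingPath {μW : Measure (ℕ → Fin 4 × Fin 4)} [IsProbabilityMeasure μW]
    (hX : IsMarkovChain (fun a => if a = 1 then 1 else 0) PXmat (μW.map fun ω n => (ω n).1))
    (hY : IsMarkovChain (fun b => if b = 0 then 1 else 0) PYmat (μW.map fun ω n => (ω n).2))
    (hΔ : μW {ω | ∀ t : ℕ, fmap (ω t).1 = gmap (ω t).2} = 1) :
    ∀ᵐ ω ∂μW, IsCouplingPath ω := by
  have hm1 : Measurable fun (ω : ℕ → Fin 4 × Fin 4) n => (ω n).1 := by fun_prop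
  have hm2 : Measurable fun (ω : ℕ → Fin 4 × Fin 4) n => (ω n).2 := by fun_prop
  have hΔm : MeasurableSet {ω : ℕ → Fin 4 × Fin 4 | ∀ t, fmap (ω t).1 = gmap (ω t).2} := by
    rw [Set.ofPred_forall]
    exact MeasurableSet.iInter fun t =>
      (measurable_pi_apply (X := fun _ => Fin 4 × Fin 4) t)
        (MeasurableSet.of_discrete (s := {p : Fin 4 × Fin 4 | fmap p.1 = gmap p.2}))
  have hΔae : ∀ᵐ ω ∂μW, ∀ t, fmap (ω t).1 = gmap (ω t).2 :=
    (prob_compl_eq_zero_iff hΔm).2 hΔ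
  filter_upwards [ae_of_ae_map hm1.aemeasurable hX.ae_init_ne_zero,
    ae_of_ae_map hm2.aemeasurable hY.ae_init_ne_zero,
    ae_of_ae_map hm1.aemeasurable hX.ae_step_ne_zero,
    ae_of_ae_map hm2.aemeasurable hY.ae_step_ne_zero, hΔae] with ω h1 h2 h3 h4 h5
  exact ⟨by simpa using h1, by simpa using h2, h3, h4, h5⟩

/-- A trajectory that leaves `(1, 0)` and comes back to it at time `4`. -/
def farWord (i : ℕ) : Fin 4 × Fin 4 :=
  [((1 : Fin 4), (0 : Fin 4)), (2, 1), (3, 2), (2, 1), (1, 0)].getD i (1, 0)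

/-- A trajectory that visits `(1, 0)` at the times `0`, `2` and `4`. -/
def nearWord (i : ℕ) : Fin 4 × Fin 4 :=
  [((1 : Fin 4), (0 : Fin 4)), (0, 1), (1, 0), (2, 1), (1, 0)].getD i (1, 0)

theorem IsCouplingPath.eq_farWord {ω : ℕ → Fin 4 × Fin 4} (hω : IsCouplingPath ω) {k : ℕ}
    (hk : k = 3 ∨ k = 4) (h : ∀ i ≤ k, (ω i).2 = (farWord i).2) (i : ℕ) (hi : i ≤ k) :
    ω i = farWord i := by
  refine Prod.ext ?_ (h i hi)
  have hX := fun k => (PXmat_ne_zero_iff _ _).1 (hω.stepX k)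
  have hΔ := fun k => (fmap_eq_gmap_iff _ _).1 (hω.mem k)
  have e0 : (ω 0).1.val = 1 := congrArg Fin.val hω.initX
  have y2 : (ω 2).2.val = 2 := congrArg Fin.val (h 2 (by omega))
  have y3 : (ω 3).2.val = 1 := congrArg Fin.val (h 3 (by omega))
  have d2 := hΔ 2
  have x1 := hX 0
  have x2 := hX 1
  have x3 := hX 2
  simp only [zero_add, Nat.reduceAdd] at x1 x2 x3
  have l2 := (ω 2).1.isLt
  have l3 := (ω 3).1.isLt
  have hi4 : i ≤ 4 := by omega
  apply Fin.ext
  interval_cases i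
  · exact e0
  · change (ω 1).1.val = 2; omega
  · change (ω 2).1.val = 3; omega
  · change (ω 3).1.val = 2; omega
  · have y4 : (ω 4).2.val = 0 := congrArg Fin.val (h 4 hi)
    have d4 := hΔ 4
    change (ω 4).1.val = 1
    omega

theorem IsCouplingPath.eq_nearWord {ω : ℕ → Fin 4 × Fin 4} (hω : IsCouplingPath ω) {k : ℕ}
    (hk : k = 3 ∨ k = 4) (h : ∀ i ≤ k, (ω i).1 = (nearWord i).1) (i : ℕ) (hi : i ≤ k) :
    ω i = nearWord i := by
  refine Prod.ext (h i hi) ?_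
  have hY := fun k => (PYmat_ne_zero_iff _ _).1 (hω.stepY k)
  have hΔ := fun k => (fmap_eq_gmap_iff _ _).1 (hω.mem k)
  have e0 : (ω 0).2.val = 0 := congrArg Fin.val hω.initY
  have x2 : (ω 2).1.val = 1 := congrArg Fin.val (h 2 (by omega))
  have d2 := hΔ 2
  have y1 := hY 0
  have y3 := hY 2
  simp only [zero_add, Nat.reduceAdd] at y1 y3
  have hi4 : i ≤ 4 := by omega
  apply Fin.ext
  interval_cases i
  · exact e0
  · change (ω 1).2.val = 1; omega
  · change (ω 2).2.val = 0; omega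
  · change (ω 3).2.val = 1; omega
  · have x4 : (ω 4).1.val = 1 := congrArg Fin.val (h 4 hi)
    have d4 := hΔ 4
    change (ω 4).2.val = 0
    omega

theorem measure_farWord {μW : Measure (ℕ → Fin 4 × Fin 4)}
    (hY : IsMarkovChain (fun b => if b = 0 then 1 else 0) PYmat (μW.map fun ω n => (ω n).2))
    (hc : ∀ᵐ ω ∂μW, IsCouplingPath ω) {k : ℕ} (hk : k = 3 ∨ k = 4) :
    μW {ω | ∀ i ≤ k, ω i = farWord i} =
      ∏ i ∈ Finset.range k, PYmat (farWord i).2 (farWord (i + 1)).2 := by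
  have h := hY.2.2.2 k fun i => (farWord i).2
  rw [Measure.map_apply (by fun_prop) (by measurability)] at h
  simp only [show (farWord 0).2 = 0 from rfl, if_true, one_mul] at h
  rw [← h]
  refine measure_congr ?_
  filter_upwards [hc] with ω hω
  exact propext ⟨fun h' i hi => congrArg Prod.snd (h' i hi), hω.eq_farWord hk⟩

theorem measure_nearWord {μW : Measure (ℕ → Fin 4 × Fin 4)}
    (hX : IsMarkovChain (fun a => if a = 1 then 1 else 0) PXmat (μW.map fun ω n => (ω n).1))
    (hc : ∀ᵐ ω ∂μW, IsCouplingPath ω) {k : ℕ} (hk : k = 3 ∨ k = 4) :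
    μW {ω | ∀ i ≤ k, ω i = nearWord i} =
      ∏ i ∈ Finset.range k, PXmat (nearWord i).1 (nearWord (i + 1)).1 := by
  have h := hX.2.2.2 k fun i => (nearWord i).1
  rw [Measure.map_apply (by fun_prop) (by measurability)] at h
  simp only [show (nearWord 0).1 = 1 from rfl, if_true, one_mul] at h
  rw [← h]
  refine measure_congr ?_
  filter_upwards [hc] with ω hω
  exact propext ⟨fun h' i hi => congrArg Prod.fst (h' i hi), hω.eq_nearWord hk⟩

end BatCave

/-- **Two Markov chains with a non-Markov common image have no Markov coupling in `Δ`.**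
With `X̄ = MC(δ_2, P_X)` and `Ȳ = MC(δ_1, P_Y)` as in the bat-cave example, `f(X̄)` and `g(Ȳ)`
are equal in law, but there is no Markov chain `(W_t) = (X_t, Y_t)`, even a time-inhomogeneous
one, taking values in `Δ(f,g)` with `X` distributed as `X̄` and `Y` distributed as `Ȳ`. -/
theorem statement_16
    (μX μY : Measure (ℕ → Fin 4))
    (hX : IsMarkovChain (fun a => if a = 1 then 1 else 0) PXmat μX)
    (hY : IsMarkovChain (fun b => if b = 0 then 1 else 0) PYmat μY) :
    μX.map (fun ω n => fmap (ω n)) = μY.map (fun ω n => gmap (ω n)) ∧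
    ¬ ∃ (αW : Fin 4 × Fin 4 → ℝ≥0∞) (PW : ℕ → Fin 4 × Fin 4 → Fin 4 × Fin 4 → ℝ≥0∞)
        (μW : Measure (ℕ → Fin 4 × Fin 4)),
        IsInhomMarkovChain αW PW μW ∧
        μW.map (fun ω n => (ω n).1) = μX ∧
        μW.map (fun ω n => (ω n).2) = μY ∧
        μW {ω | ∀ t : ℕ, fmap (ω t).1 = gmap (ω t).2} = 1 := by
  refine ⟨map_fmap_eq_map_gmap hX hY, ?_⟩
  rintro ⟨αW, PW, μW, ⟨hprob, -, -, hW⟩, rfl, rfl, hΔ⟩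
  have hc := ae_isCouplingPath hX hY hΔ
  have step (a : ℕ → Fin 4 × Fin 4) : μW {ω | ∀ i ≤ 4, ω i = a i} =
      μW {ω | ∀ i ≤ 3, ω i = a i} * PW 4 (a 3) (a 4) := by
    rw [hW, hW, Finset.prod_range_succ _ 3, mul_assoc]
  have far := congrArg ENNReal.toReal (step farWord)
  have near := congrArg ENNReal.toReal (step nearWord)
  rw [measure_farWord hY hc (.inl rfl), measure_farWord hY hc (.inr rfl)] at far
  rw [measure_nearWord hX hc (.inl rfl), measure_nearWord hX hc (.inr rfl)] at near
  simp [Finset.prod_range_succ, farWord, nearWord, PXmat, PYmat] at far near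
  linarith
end
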